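/- arXiv:1106.2949 — 3 statements merged into one kernel-verified Lean document; each statement's English description precedes it below -/
import Mathlib

section
/- Let n ≥ 2 be an even natural number and let Q be a Sylow 2-subgroup of the alternating group 𝔄_n. Then the centralizer C_{𝔖_n}(Q) of Q in the symmetric group 𝔖_n is a 2-group, i.e., every element of C_{𝔖_n}(Q) has order a power of 2. -/
open Equiv Equiv.Perm in
/-- A permutation of odd order that has a point of `2`-power period fixes that point. -/
theorem Equiv.Perm.apply_eq_self_of_odd_of_two_pow {α : Type*} {c : Perm α} {m : ℕ} (hm : Odd m)
    (hc : c ^ m = 1) {x : α} {k : ℕ} (hx : (c ^ 2 ^ k) x = x) : c x = x := by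
  have h1 : Function.IsPeriodicPt c m x := by
    simp [Function.IsPeriodicPt, Function.IsFixedPt, Perm.iterate_eq_pow, hc]
  have h2 : Function.IsPeriodicPt c (2 ^ k) x := by
    simpa [Function.IsPeriodicPt, Function.IsFixedPt, Perm.iterate_eq_pow] using hx
  have h3 := h1.gcd h2
  rw [Nat.Coprime.gcd_eq_one ((Nat.coprime_two_right.2 hm).pow_right k)] at h3
  simpa [Function.IsPeriodicPt, Function.IsFixedPt] using h3

/-- An element of `p`-power order of a subgroup `A` that centralizes a `p`-subgroup of maximal
order among those contained in `A` lies in that `p`-subgroup. -/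
theorem IsPGroup.mem_of_commute_of_card_maximal {G : Type*} [Group G] [Finite G] {p : ℕ}
    {A Q : Subgroup G} (hQA : Q ≤ A) (hQ : IsPGroup p Q)
    (hQmax : ∀ R : Subgroup G, R ≤ A → IsPGroup p R → Nat.card R ≤ Nat.card Q)
    {t : G} (htA : t ∈ A) {k : ℕ} (ht : t ^ p ^ k = 1) (hcomm : ∀ q ∈ Q, q * t = t * q) :
    t ∈ Q := by
  have hZ : IsPGroup p (Subgroup.zpowers t) := by
    rintro ⟨_, i, rfl⟩
    refine ⟨k, Subtype.ext ?_⟩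
    change (t ^ i) ^ p ^ k = 1
    rw [← zpow_natCast, ← zpow_mul, mul_comm, zpow_mul, zpow_natCast, ht, one_zpow]
  have hnorm : Subgroup.zpowers t ≤ Subgroup.normalizer (Q : Set G) := by
    rw [Subgroup.zpowers_le]
    exact Subgroup.centralizer_le_normalizer (Q : Set G) (Subgroup.mem_centralizer_iff.2 hcomm)
  have hR := hQmax (Q ⊔ Subgroup.zpowers t) (sup_le hQA (by simpa using htA))
    (hQ.to_sup_of_normal_left' hZ hnorm)
  rw [Subgroup.eq_of_le_of_card_ge le_sup_left hR]
  exact Subgroup.mem_sup_right (Subgroup.mem_zpowers t)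

open Equiv Equiv.Perm in
/-- The involution exchanging a set `O` with its disjoint image under `c` by means of `c`. -/
theorem Equiv.Perm.exists_swap_image {α : Type*} [Fintype α] [DecidableEq α] (c : Perm α)
    (O : Finset α) (hO : ∀ y ∈ O, c y ∉ O) :
    ∃ t : Perm α, t ^ 2 = 1 ∧ sign t = (-1) ^ O.card ∧ (∀ y ∈ O, t y = c y) ∧
      (∀ y, c⁻¹ y ∈ O → t y = c⁻¹ y) ∧ ∀ y, y ∉ O → c⁻¹ y ∉ O → t y = y := by
  set f : α → α := fun y => if y ∈ O then c y else if c⁻¹ y ∈ O then c⁻¹ y else y with hf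
  have hO' : ∀ y, c⁻¹ y ∈ O → y ∉ O := fun y h => by simpa using hO _ h
  have h1 : ∀ y ∈ O, f y = c y := fun y h => by simp [hf, h]
  have h2 : ∀ y, c⁻¹ y ∈ O → f y = c⁻¹ y := fun y h => by
    simp only [hf, if_neg (hO' y h), if_pos h]
  have h3 : ∀ y, y ∉ O → c⁻¹ y ∉ O → f y = y := fun y h h' => by
    simp only [hf, if_neg h, if_neg h']
  have hinv : Function.Involutive f := by
    intro y
    by_cases hy : y ∈ O
    · rw [h1 y hy, h2 (c y) (by simpa using hy)]; simp
    by_cases hy' : c⁻¹ y ∈ O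
    · rw [h2 y hy', h1 _ hy']; simp
    rw [h3 y hy hy', h3 y hy hy']
  have hsq : hinv.toPerm f ^ 2 = 1 := by
    ext y; simpa [sq] using hinv y
  have hsupp : (hinv.toPerm f).support = O ∪ O.map c.toEmbedding := by
    ext y
    have hmap : y ∈ O.map c.toEmbedding ↔ c⁻¹ y ∈ O := by simp [Perm.inv_def]
    rw [Perm.mem_support, Finset.mem_union, hmap, Function.Involutive.coe_toPerm]
    by_cases hy : y ∈ O
    · rw [h1 y hy]
      exact iff_of_true (fun h => hO y hy (h.symm ▸ hy)) (Or.inl hy)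
    by_cases hy' : c⁻¹ y ∈ O
    · rw [h2 y hy']
      exact iff_of_true (fun h => hy (h ▸ hy')) (Or.inr hy')
    rw [h3 y hy hy']
    exact iff_of_false (fun h => h rfl) (not_or.2 ⟨hy, hy'⟩)
  have hdisj : _root_.Disjoint O (O.map c.toEmbedding) := by
    rw [Finset.disjoint_left]
    intro y hy hy'
    obtain ⟨z, hz, rfl⟩ := Finset.mem_map.1 hy'
    exact hO z hz hy
  refine ⟨hinv.toPerm f, hsq, ?_, h1, h2, h3⟩
  rw [sign_of_pow_two_eq_one hsq, card_fixedPoints,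
    Nat.sub_sub_self (sum_cycleType_le _), sum_cycleType, hsupp, Finset.card_union_of_disjoint hdisj, Finset.card_map,
    ← two_mul, Nat.mul_div_cancel_left _ two_pos]

section MaximalTwoSubgroup

open Equiv Equiv.Perm MulAction

variable {α : Type*} [Fintype α] [DecidableEq α] {Q : Subgroup (Perm α)}

/-- A `2`-subgroup of maximal order in the alternating group of an even number of points has at
most two fixed points. -/
theorem card_fixedPoints_le_two_of_card_maximal (heven : Even (Fintype.card α))
    (hQA : Q ≤ alternatingGroup α) (hQ : IsPGroup 2 Q)
    (hQmax : ∀ R : Subgroup (Perm α), R ≤ alternatingGroup α → IsPGroup 2 R →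
      Nat.card R ≤ Nat.card Q) :
    Nat.card (fixedPoints Q α) ≤ 2 := by
  classical
  by_contra! hlt
  have hmod := hQ.card_modEq_card_fixedPoints α
  rw [Nat.card_eq_fintype_card (α := α)] at hmod
  have h4 : 4 ≤ (fixedPoints Q α).toFinset.card := by
    have : Nat.card (fixedPoints Q α) = (fixedPoints Q α).toFinset.card := by
      rw [Nat.card_eq_fintype_card, Set.toFinset_card]
    unfold Nat.ModEq at hmod
    have := Nat.even_iff.1 heven
    omega
  obtain ⟨s, hs, hscard⟩ := Finset.exists_subset_card_eq h4
  obtain ⟨a, b, c, d, hab, hac, had, hbc, hbd, hcd, rfl⟩ := Finset.card_eq_four.1 hscard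
  have hfix : ∀ y ∈ ({a, b, c, d} : Finset α), ∀ q ∈ Q, q y = y := fun y hy q hq =>
    (Set.mem_toFinset.1 (hs hy) : y ∈ fixedPoints Q α) ⟨q, hq⟩
  have hcomm : ∀ x ∈ ({a, b, c, d} : Finset α), ∀ y ∈ ({a, b, c, d} : Finset α), ∀ q ∈ Q,
      q * swap x y = swap x y * q := fun x hx y hy q hq => by
    rw [mul_swap_eq_swap_mul, hfix x hx q hq, hfix y hy q hq]
  have hdis : Commute (swap a b) (swap c d) :=
    (Perm.disjoint_iff_disjoint_support.2 (by
      rw [support_swap hab, support_swap hcd]; simp [*, Ne.symm])).commute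
  have ht : swap a b * swap c d ∈ Q := by
    refine hQ.mem_of_commute_of_card_maximal hQA hQmax (k := 1) ?_ ?_ fun q hq => ?_
    · simp [mem_alternatingGroup, sign_swap hab, sign_swap hcd]
    · rw [pow_one, hdis.mul_pow, sq, sq, swap_mul_self, swap_mul_self, one_mul]
    · rw [← mul_assoc, hcomm a (by simp) b (by simp) q hq, mul_assoc,
        hcomm c (by simp) d (by simp) q hq, mul_assoc]
  have := hfix a (by simp) _ ht
  rw [Perm.mul_apply, swap_apply_of_ne_of_ne hac had, swap_apply_left] at this
  exact hab this.symm

/-- A permutation of odd order centralizing a `2`-subgroup of maximal order in the alternating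
group of an even number of points is trivial. -/
theorem eq_one_of_odd_of_mem_centralizer_of_card_maximal (heven : Even (Fintype.card α))
    (hQA : Q ≤ alternatingGroup α) (hQ : IsPGroup 2 Q)
    (hQmax : ∀ R : Subgroup (Perm α), R ≤ alternatingGroup α → IsPGroup 2 R →
      Nat.card R ≤ Nat.card Q)
    {c : Perm α} (hcomm : ∀ q ∈ Q, q * c = c * q) {m : ℕ} (hm : Odd m) (hcm : c ^ m = 1) :
    c = 1 := by
  classical
  have happ : ∀ q ∈ Q, ∀ y, q (c y) = c (q y) := fun q hq y => DFunLike.congr_fun (hcomm q hq) y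
  have happ' : ∀ q ∈ Q, ∀ y, c⁻¹ (q y) = q (c⁻¹ y) := fun q hq y => by
    rw [Perm.inv_eq_iff_eq, ← happ q hq]; simp
  ext1 x
  rw [Perm.one_apply]
  by_cases hxF : x ∈ fixedPoints Q α
  · have hcF : ∀ y ∈ fixedPoints Q α, c y ∈ fixedPoints Q α := fun y hy q => by
      have := happ q q.2 y
      rwa [show (q : Perm α) y = y from hy q] at this
    have hle : (fixedPoints Q α).toFinset.card ≤ 2 := by
      rw [Set.toFinset_card, ← Nat.card_eq_fintype_card]
      exact card_fixedPoints_le_two_of_card_maximal heven hQA hQ hQmax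
    refine apply_eq_self_of_odd_of_two_pow hm hcm (k := 1) ?_
    by_contra hne
    have hne1 : c x ≠ x := fun h => hne (by simp [sq, h])
    have hsub : ({x, c x, c (c x)} : Finset α) ⊆ (fixedPoints Q α).toFinset := by
      intro y hy
      simp only [Finset.mem_insert, Finset.mem_singleton] at hy
      rw [Set.mem_toFinset]
      rcases hy with rfl | rfl | rfl
      exacts [hxF, hcF _ hxF, hcF _ (hcF _ hxF)]
    have h3 : ({x, c x, c (c x)} : Finset α).card = 3 := by
      refine Finset.card_eq_three.2 ⟨_, _, _, hne1.symm, fun h => hne ?_, fun h => hne1 ?_, rfl⟩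
      · simpa [sq] using h.symm
      · exact (c.injective h).symm
    have := Finset.card_le_card hsub
    omega
  by_cases hcx : c x ∈ orbit Q x
  · obtain ⟨q, hq⟩ := hcx
    obtain ⟨k, hk⟩ := hQ q
    refine apply_eq_self_of_odd_of_two_pow hm hcm (k := k) ?_
    have hpow : ∀ j : ℕ, (c ^ j) x = ((q : Perm α) ^ j) x := by
      intro j
      induction j with
      | zero => simp
      | succ j ih =>
        rw [pow_succ', Perm.mul_apply, ih, ← happ _ (Q.pow_mem q.2 j), ← hq, pow_succ,
          Perm.mul_apply]
        rfl
    rw [hpow, show (q : Perm α) ^ 2 ^ k = 1 from congrArg Subtype.val hk, Perm.one_apply]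
  exfalso
  set O : Finset α := (orbit Q x).toFinset with hOdef
  have hOQ : ∀ q ∈ Q, ∀ y, q y ∈ O ↔ y ∈ O := fun q hq y => by
    rw [hOdef, Set.mem_toFinset, Set.mem_toFinset]
    rw [← orbit_eq_iff, ← orbit_eq_iff, ← orbit_smul (⟨q, hq⟩ : Q) y]
    rfl
  have hO : ∀ y ∈ O, c y ∉ O := by
    intro y hy hy'
    rw [hOdef, Set.mem_toFinset] at hy
    obtain ⟨q, rfl⟩ := hy
    change c ((q : Perm α) x) ∈ O at hy'
    rw [← happ q q.2, hOQ q q.2, hOdef, Set.mem_toFinset] at hy'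
    exact hcx hy'
  have hxO : x ∈ O := by simp [hOdef]
  have hOeven : Even O.card := by
    obtain ⟨k, hk⟩ := hQ.card_orbit x
    have hOk : O.card = 2 ^ k := by
      rw [← hk, hOdef, Set.toFinset_card, Nat.card_eq_fintype_card]
    rw [hOk]
    refine Nat.even_pow.2 ⟨even_two, ?_⟩
    rintro rfl
    refine hxF fun q => ?_
    have h1 := Finset.card_le_one.1 (by rw [hOk, pow_zero])
    exact h1 _ ((hOQ q q.2 x).2 hxO) x hxO
  obtain ⟨t, ht2, hsign, ht, htinv, htfix⟩ := exists_swap_image c O hO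
  have htQ : t ∈ Q := by
    refine hQ.mem_of_commute_of_card_maximal hQA hQmax (k := 1) ?_ (by simpa using ht2) ?_
    · rw [mem_alternatingGroup, hsign, hOeven.neg_one_pow]
    intro q hq
    ext1 y
    rw [Perm.mul_apply, Perm.mul_apply]
    by_cases hy : y ∈ O
    · rw [ht y hy, ht _ ((hOQ q hq y).2 hy), happ q hq]
    by_cases hy' : c⁻¹ y ∈ O
    · rw [htinv y hy', htinv _ (by rwa [happ' q hq, hOQ q hq]), happ' q hq]
    rw [htfix y hy hy', htfix _ (by rwa [hOQ q hq]) (by rwa [happ' q hq, hOQ q hq])]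
  refine hO x hxO ?_
  rw [← ht x hxO]
  exact (hOQ t htQ x).2 hxO

end MaximalTwoSubgroup

/-- Let `n ≥ 2` be even and let `Q` be a Sylow `2`-subgroup of the
alternating group `𝔄_n` (a `2`-subgroup of `𝔄_n` of maximal possible order). Then the
centralizer `C_{𝔖_n}(Q)` of `Q` in the symmetric group `𝔖_n` is a `2`-group, i.e. every
element of `C_{𝔖_n}(Q)` has order a power of `2`. -/
theorem centralizer_sylow_two_alternating_isPGroup
    (n : ℕ) (hn2 : 2 ≤ n) (heven : Even n)
    (Q : Subgroup (Equiv.Perm (Fin n))) (hQA : Q ≤ alternatingGroup (Fin n))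
    (hQ2 : IsPGroup 2 Q)
    (hQmax : ∀ R : Subgroup (Equiv.Perm (Fin n)), R ≤ alternatingGroup (Fin n) →
      IsPGroup 2 R → Nat.card R ≤ Nat.card Q) :
    IsPGroup 2 (Subgroup.centralizer (Q : Set (Equiv.Perm (Fin n)))) := by
  rintro ⟨g, hg⟩
  rw [Subgroup.mem_centralizer_iff] at hg
  obtain ⟨k, m, hm, hk⟩ := Nat.exists_eq_two_pow_mul_odd (orderOf_pos g).ne'
  refine ⟨k, Subtype.ext ?_⟩
  refine eq_one_of_odd_of_mem_centralizer_of_card_maximal (by simpa using heven) hQA hQ2 hQmax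
    (c := g ^ 2 ^ k) (fun q hq => ?_) hm (by rw [← pow_mul, ← hk, pow_orderOf_eq_one])
  exact (show Commute q g from hg q hq).pow_right _
end

section
/- Let Ω be a finite set and let Q ≤ Alt(Ω) be a 2-subgroup of the alternating group on Ω that acts fixed point freely on Ω and satisfies C_{Alt(Ω)}(Q) = Z(Q). Then |Ω| ≤ |Q| + 2. -/
theorem IsPGroup.exists_notMem_sq_mem_of_ne_top {G : Type*} [Group G] [Finite G]
    (hG : IsPGroup 2 G) {H : Subgroup G} (hH : H ≠ ⊤) :
    ∃ n ∉ H, n ^ 2 ∈ H ∧ ∀ h ∈ H, n⁻¹ * h * n ∈ H := by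
  have := hG.isNilpotent
  obtain ⟨-, n, hn, hnH⟩ := SetLike.lt_iff_le_and_exists.1
    (Group.normalizerCondition_of_isNilpotent (G := G) H hH.lt_top)
  have hex : ∃ k, n ^ 2 ^ k ∈ H := by
    obtain ⟨k, hk⟩ := hG n
    exact ⟨k, hk ▸ H.one_mem⟩
  classical
  have hpos : Nat.find hex ≠ 0 := fun h0 ↦ hnH (by simpa [h0] using Nat.find_spec hex)
  obtain ⟨j, hj⟩ := Nat.exists_eq_succ_of_ne_zero hpos
  refine ⟨n ^ 2 ^ j, Nat.find_min hex (by omega), ?_, fun h hh ↦ ?_⟩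
  · rw [← pow_mul, ← pow_succ, ← Nat.succ_eq_add_one, ← hj]
    exact Nat.find_spec hex
  · exact (Subgroup.mem_normalizer_iff''.1 (pow_mem hn _) h).1 hh

open MulAction in
/-- A fixed point free action of a finite `2`-group commutes with an involution which moves every
point and preserves every orbit. -/
theorem IsPGroup.exists_equivariant_involutive {G α : Type*} [Group G] [Finite G] [MulAction G α]
    (hG : IsPGroup 2 G) (hfix : ∀ a : α, ∃ g : G, g • a ≠ a) :
    ∃ z : α → α, Function.Involutive z ∧ (∀ (g : G) a, z (g • a) = g • z a) ∧
      (∀ a, z a ≠ a) ∧ ∀ a, z a ∈ orbit G a := by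
  have hstab (a : α) : stabilizer G a ≠ ⊤ := fun h ↦ by
    obtain ⟨g, hg⟩ := hfix a
    exact hg (mem_stabilizer_iff.1 (h ▸ Subgroup.mem_top g))
  choose n hn hn2 hconj using fun a : α ↦ hG.exists_notMem_sq_mem_of_ne_top (hstab a)
  let base (a : α) : α := (Quotient.mk (orbitRel G α) a).out
  have hbase (g : G) (a : α) : base (g • a) = base a :=
    congrArg Quotient.out (Quotient.sound (s := orbitRel G α) ⟨g, rfl⟩)
  have hrep (a : α) : ∃ g : G, g • base a = a := by
    obtain ⟨g, hg⟩ := Quotient.mk_out (s := orbitRel G α) a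
    refine ⟨g⁻¹, ?_⟩
    rw [inv_smul_eq_iff]
    exact hg.symm
  choose q hq using hrep
  have hbase_base (a : α) : base (base a) = base a := by
    conv_rhs => rw [← hq a, hbase]
  let z (a : α) : α := q a • n (base a) • base a
  have key (g : G) (a : α) : z (g • base a) = g • n (base a) • base a := by
    have hb : base (g • base a) = base a := by rw [hbase, hbase_base]
    have hmem : g⁻¹ * q (g • base a) ∈ stabilizer G (base a) := by
      have := hq (g • base a)
      rw [hb] at this
      rw [mem_stabilizer_iff, mul_smul, this, inv_smul_smul]
    have h := mem_stabilizer_iff.1 (hconj _ _ hmem)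
    simp only [mul_smul, inv_smul_eq_iff] at h
    simp only [z, hb]
    exact h
  refine ⟨z, fun a ↦ ?_, fun g a ↦ ?_, fun a ha ↦ ?_, fun a ↦ ?_⟩
  · have h : z (z a) = (q a * n (base a)) • n (base a) • base a := by
      rw [← key, mul_smul]
    rw [h, mul_smul, ← mul_smul (n _) (n _), ← pow_two, mem_stabilizer_iff.1 (hn2 (base a)), hq]
  · conv_lhs => rw [← hq a, ← mul_smul, key, mul_smul]
  · refine hn (base a) (mem_stabilizer_iff.2 (smul_left_cancel (q a) ?_))
    rw [hq]
    exact ha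
  · refine ⟨q a * n (base a) * (q a)⁻¹, ?_⟩
    simp only [mul_smul, z]
    rw [inv_smul_eq_iff.2 (hq a).symm]

theorem Equiv.Perm.sign_eq_one_of_four_dvd_card_support {α : Type*} [Fintype α] [DecidableEq α]
    {σ : Equiv.Perm α} (hσ : σ ^ 2 = 1) (h : 4 ∣ σ.support.card) : σ.sign = 1 := by
  have hc := cycleType_of_pow_prime_eq_one hσ
  rw [sign_of_cycleType, neg_one_pow_eq_one_iff_even (by decide), sum_cycleType]
  have h2 : σ.support.card = σ.cycleType.card * 2 := by
    rw [← sum_cycleType, hc]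
    simp
  rw [Nat.even_iff]
  omega

/-- The permutation agreeing with the involution `z` on the fibres of `π` over `S` and trivial on
the other fibres. -/
def involutionOnFibers {α β : Type*} [DecidableEq β] {z : α → α} (hz : Function.Involutive z)
    {π : α → β} (hπ : ∀ a, π (z a) = π a) (S : Finset β) : Equiv.Perm α :=
  Function.Involutive.toPerm (fun a ↦ if π a ∈ S then z a else a) fun a ↦ by
    by_cases h : π a ∈ S <;> simp [h, hπ, hz a]

section involutionOnFibers

variable {α β : Type*} [DecidableEq β] {z : α → α} (hz : Function.Involutive z)
  {π : α → β} (hπ : ∀ a, π (z a) = π a)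

theorem involutionOnFibers_apply (S : Finset β) (a : α) :
    involutionOnFibers hz hπ S a = if π a ∈ S then z a else a := rfl

theorem involutionOnFibers_sq (S : Finset β) : involutionOnFibers hz hπ S ^ 2 = 1 := by
  ext a
  by_cases h : π a ∈ S <;> simp [pow_two, involutionOnFibers_apply, h, hπ, hz a]

theorem involutionOnFibers_apply_ne_iff (hne : ∀ a, z a ≠ a) (S : Finset β) (a : α) :
    involutionOnFibers hz hπ S a ≠ a ↔ π a ∈ S := by
  by_cases h : π a ∈ S <;> simp [involutionOnFibers_apply, h, hne]

theorem involutionOnFibers_injective (hne : ∀ a, z a ≠ a) (hsurj : Function.Surjective π) :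
    Function.Injective (involutionOnFibers hz hπ) := fun S T h ↦ by
  ext b
  obtain ⟨a, rfl⟩ := hsurj b
  rw [← involutionOnFibers_apply_ne_iff hz hπ hne, h, involutionOnFibers_apply_ne_iff hz hπ hne]

theorem sign_involutionOnFibers [Fintype α] [DecidableEq α] (hne : ∀ a, z a ≠ a) {S : Finset β}
    (hS : 4 ∣ ∑ b ∈ S, (Finset.univ.filter fun a ↦ π a = b).card) :
    (involutionOnFibers hz hπ S).sign = 1 := by
  refine Equiv.Perm.sign_eq_one_of_four_dvd_card_support (involutionOnFibers_sq hz hπ S) ?_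
  have h : (involutionOnFibers hz hπ S).support = Finset.univ.filter fun a ↦ π a ∈ S := by
    ext a
    simp [involutionOnFibers_apply_ne_iff hz hπ hne]
  rw [h, Finset.card_eq_sum_card_fiberwise (f := π) (t := S) (by intro a; simp)]
  convert! hS using 3 with b hb
  ext a
  simp only [Finset.mem_filter, Finset.mem_univ, true_and, and_iff_right_iff_imp]
  rintro rfl
  exact hb

end involutionOnFibers

theorem sum_le_add_two_of_forall_card_le {β : Type*} [Fintype β] [DecidableEq β] {w : β → ℕ}
    {o : β} {N : ℕ} (hmax : ∀ b, w b ≤ w o) (hw : ∀ b, w b = 2 ∨ 4 ∣ w b)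
    (hF : ∀ F : Finset (Finset β), (∀ S ∈ F, o ∉ S ∧ 4 ∣ ∑ b ∈ S, w b) → w o * F.card ≤ N) :
    ∑ b, w b ≤ N + 2 := by
  classical
  by_cases h : ∃ a, a ≠ o ∧ w a = 2
  · obtain ⟨a, hao, ha⟩ := h
    let f (b : β) : Finset β := if b = a then ∅ else if w b = 2 then {a, b} else {b}
    have hinj : Function.Injective f := fun b c hbc ↦ by
      have hmem (d x : β) (hx : x ≠ a) : x ∈ f d ↔ x = d := by
        simp only [f]
        split_ifs with h1 h2 <;> simp [hx]
        rintro rfl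
        exact hx h1
      by_cases hb : b = a
      · by_contra hne
        have hc : c ≠ a := fun hc ↦ hne (hb.trans hc.symm)
        exact hne ((hmem b c hc).1 (hbc ▸ (hmem c c hc).2 rfl)).symm
      · exact (hmem c b hb).1 (hbc ▸ (hmem b b hb).2 rfl)
    have key := hF ((Finset.univ.erase o).image f) fun S hS ↦ by
      obtain ⟨b, hb, rfl⟩ := Finset.mem_image.1 hS
      have hbo := Finset.ne_of_mem_erase hb
      simp only [f]
      split_ifs with h1 h2
      · simp
      · rw [Finset.sum_pair (Ne.symm h1), ha, h2]
        simp [hao.symm, hbo.symm]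
      · simpa [hbo.symm] using (hw b).resolve_left h2
    rw [Finset.card_image_of_injective _ hinj] at key
    have ha' : a ∈ Finset.univ.erase o := by simp [hao]
    rw [← Finset.add_sum_erase _ _ (Finset.mem_univ o), ← Finset.add_sum_erase _ _ ha', ha]
    have hle := Finset.sum_le_card_nsmul ((Finset.univ.erase o).erase a) (fun b ↦ w b) (w o) fun b _ ↦ hmax b
    rw [← Finset.card_erase_add_one ha', mul_add, mul_one, mul_comm] at key
    rw [smul_eq_mul] at hle
    omega
  · push Not at h
    let f (b : β) : Finset β := if b = o then ∅ else {b}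
    have hmem (d x : β) (hx : x ≠ o) : x ∈ f d ↔ x = d := by
      simp only [f]
      split_ifs with h1 <;> simp [h1, hx]
    have hinj : Function.Injective f := fun b c hbc ↦ by
      by_cases hb : b = o
      · by_contra hne
        have hc : c ≠ o := fun hc ↦ hne (hb.trans hc.symm)
        exact hne ((hmem b c hc).1 (hbc ▸ (hmem c c hc).2 rfl)).symm
      · exact (hmem c b hb).1 (hbc ▸ (hmem b b hb).2 rfl)
    have key := hF (Finset.univ.image f) fun S hS ↦ by
      obtain ⟨b, -, rfl⟩ := Finset.mem_image.1 hS
      simp only [f]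
      split_ifs with h1
      · simp
      · simpa [Ne.symm h1] using (hw b).resolve_left (h b h1)
    rw [Finset.card_image_of_injective _ hinj] at key
    have hle := Finset.sum_le_card_nsmul Finset.univ (fun b ↦ w b) (w o) fun b _ ↦ hmax b
    rw [smul_eq_mul, mul_comm] at hle
    omega

/-- Let `Ω` be a finite set and let `Q ≤ Alt(Ω)` be a `2`-subgroup of the
alternating group on `Ω` acting fixed point freely on `Ω` and satisfying
`C_{Alt(Ω)}(Q) = Z(Q)` (where `C_{Alt(Ω)}(Q) = C_{Sym(Ω)}(Q) ⊓ Alt(Ω)` and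
`Z(Q) = C_{Sym(Ω)}(Q) ⊓ Q`). Then `|Ω| ≤ |Q| + 2`. -/
theorem card_le_card_add_two_of_fixedPointFree_selfCentralizing
    (Ω : Type*) [Fintype Ω] [DecidableEq Ω]
    (Q : Subgroup (Equiv.Perm Ω)) (hQA : Q ≤ alternatingGroup Ω)
    (hQ2 : IsPGroup 2 Q)
    (hfpf : ∀ ω : Ω, ∃ q ∈ Q, q ω ≠ ω)
    (hsc : Subgroup.centralizer (Q : Set (Equiv.Perm Ω)) ⊓ alternatingGroup Ω
      = Subgroup.centralizer (Q : Set (Equiv.Perm Ω)) ⊓ Q) :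
    Nat.card Ω ≤ Nat.card Q + 2 := by
  classical
  obtain hΩ | hΩ := isEmpty_or_nonempty Ω
  · simp
  obtain ⟨z, hz, hcomm, hne, horb⟩ := hQ2.exists_equivariant_involutive (α := Ω) fun a ↦ by
    obtain ⟨q, hq, hqa⟩ := hfpf a
    exact ⟨⟨q, hq⟩, hqa⟩
  let π : Ω → MulAction.orbitRel.Quotient Q Ω := Quotient.mk _
  have hπ_iff (a b : Ω) : π a = π b ↔ a ∈ MulAction.orbit Q b := Quotient.eq
  have hπ (a : Ω) : π (z a) = π a := (hπ_iff _ _).2 (horb a)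
  have hπq (q : Q) (a : Ω) : π (q • a) = π a := (hπ_iff _ _).2 ⟨q, rfl⟩
  have hsurj : Function.Surjective π := Quotient.mk_surjective
  let w (b : MulAction.orbitRel.Quotient Q Ω) : ℕ := (Finset.univ.filter fun a ↦ π a = b).card
  have hw_orbit (a : Ω) : w (π a) = Nat.card (MulAction.orbit Q a) := by
    rw [Nat.card_coe_set_eq, Set.ncard_eq_toFinset_card']
    simp only [w]
    congr 1
    ext b
    simp [hπ_iff]
  have hw (b) : w b = 2 ∨ 4 ∣ w b := by
    obtain ⟨a, rfl⟩ := hsurj b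
    obtain ⟨k, hk⟩ := hQ2.card_orbit a
    have h1 : 1 < w (π a) :=
      Finset.one_lt_card.2 ⟨z a, by simp [hπ], a, by simp, hne a⟩
    rw [← hw_orbit] at hk
    match k, hk with
    | 0, hk => omega
    | 1, hk => exact .inl hk
    | k + 2, hk => exact .inr ⟨2 ^ k, by rw [hk]; ring⟩
  have hmemQ (S) (hS : 4 ∣ ∑ b ∈ S, w b) : involutionOnFibers hz hπ S ∈ Q := by
    have hmem : involutionOnFibers hz hπ S ∈
        Subgroup.centralizer (Q : Set (Equiv.Perm Ω)) ⊓ alternatingGroup Ω := by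
      refine ⟨Subgroup.mem_centralizer_iff.2 fun q hq ↦ Equiv.ext fun a ↦ ?_,
        Equiv.Perm.mem_alternatingGroup.2 (sign_involutionOnFibers hz hπ hne hS)⟩
      have h1 : π (q a) = π a := hπq ⟨q, hq⟩ a
      have h2 : z (q a) = q (z a) := hcomm ⟨q, hq⟩ a
      by_cases h : π a ∈ S <;> simp [involutionOnFibers_apply, h1, h2, h]
    exact (hsc ▸ hmem).2
  have hsum : Nat.card Ω = ∑ b, w b := by
    rw [Nat.card_eq_fintype_card, ← Finset.card_univ,
      Finset.card_eq_sum_card_fiberwise (f := π) (t := Finset.univ) (by simp)]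
  have := hΩ.map π
  obtain ⟨o, ho⟩ := Finite.exists_max w
  obtain ⟨ω, rfl⟩ := hsurj o
  rw [hsum]
  refine sum_le_add_two_of_forall_card_le ho hw fun F hF ↦ ?_
  have hcard : F.card ≤ Nat.card (MulAction.stabilizer Q ω) := by
    let f (S : F) : MulAction.stabilizer Q ω :=
      ⟨⟨involutionOnFibers hz hπ S, hmemQ S (hF S S.2).2⟩, by
        simp [MulAction.mem_stabilizer_iff, Subgroup.smul_def, involutionOnFibers_apply,
          (hF S S.2).1]⟩
    have hf : Function.Injective f := fun S T h ↦ Subtype.ext <|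
      involutionOnFibers_injective hz hπ hne hsurj <|
        congrArg (fun s : MulAction.stabilizer Q ω ↦ ((s : Q) : Equiv.Perm Ω)) h
    simpa using Nat.card_le_card_of_injective f hf
  calc w (π ω) * F.card ≤ Nat.card (MulAction.orbit Q ω) * Nat.card (MulAction.stabilizer Q ω) := by
        rw [hw_orbit]
        gcongr
    _ = Nat.card Q := by
        simpa only [Nat.card_eq_fintype_card] using
          MulAction.card_orbit_mul_card_stabilizer_eq_card_group Q ω
end

section
/- Let Ω be a finite set and let Q ≤ Alt(Ω) be a 2-subgroup of the alternating group on Ω that acts fixed point freely on Ω and satisfies C_{Alt(Ω)}(Q) = Z(Q). If Q has exactly k orbits on Ω with k ≥ 2, then 2^(k-2) · |Ω| ≤ k · |Q| (equivalently, 2^k · |Ω| ≤ 4k · |Q|). -/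
/-- The orbit of the point `ω` under a subgroup `Q` of the permutation group of `Ω`. -/
def permOrbit {Ω : Type*} (Q : Subgroup (Equiv.Perm Ω)) (ω : Ω) : Set Ω :=
  {x | ∃ q ∈ Q, q ω = x}

/-- If a finite `p`-group moves `ω`, then some group element acts nontrivially on the orbit of `ω`
and commutes there with the action of the whole group. -/
theorem IsPGroup.exists_smul_comm_on_orbit {p : ℕ} [Fact p.Prime] {G α : Type*} [Group G] [Finite G]
    [MulAction G α] (hG : IsPGroup p G) (ω : α) (hω : ∃ g : G, g • ω ≠ ω) :
    ∃ q : G, (∃ x ∈ MulAction.orbit G ω, q • x ≠ x) ∧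
      ∀ g : G, ∀ x ∈ MulAction.orbit G ω, q • g • x = g • q • x := by
  let f := MulAction.toPermHom G (MulAction.orbit G ω)
  have hf : IsPGroup p f.range := hG.of_surjective f.rangeRestrict f.rangeRestrict_surjective
  obtain ⟨g, hg⟩ := hω
  have : Nontrivial f.range := by
    refine ⟨⟨f g, g, rfl⟩, 1, fun h => hg ?_⟩
    have h1 : f g = 1 := congrArg Subtype.val h
    exact congrArg Subtype.val (DFunLike.congr_fun h1 ⟨ω, MulAction.mem_orbit_self ω⟩)
  have : Finite f.range := Finite.of_surjective _ f.rangeRestrict_surjective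
  have := hf.center_nontrivial
  obtain ⟨⟨⟨_, q, rfl⟩, hz⟩, hne⟩ := exists_ne (1 : Subgroup.center f.range)
  refine ⟨q, ?_, fun g x hx => ?_⟩
  · by_contra! h
    apply hne
    ext ⟨x, hx⟩
    exact h x hx
  · have h := congrArg Subtype.val (Subgroup.mem_center_iff.1 hz ⟨f g, g, rfl⟩)
    exact (congrArg Subtype.val (DFunLike.congr_fun h ⟨x, hx⟩)).symm

/-- The permutation acting on each orbit through a group element chosen for that orbit. -/
def MulAction.orbitwisePerm {G α : Type*} [Group G] [MulAction G α]
    (g : MulAction.orbitRel.Quotient G α → G) : Equiv.Perm α where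
  toFun x := g (Quotient.mk _ x) • x
  invFun x := (g (Quotient.mk _ x))⁻¹ • x
  left_inv x := by
    change (g (Quotient.mk _ (g (Quotient.mk _ x) • x)))⁻¹ • g (Quotient.mk _ x) • x = x
    rw [show (Quotient.mk _ (g (Quotient.mk _ x) • x) : MulAction.orbitRel.Quotient G α) =
      Quotient.mk _ x from Quotient.sound ⟨_, rfl⟩, inv_smul_smul]
  right_inv x := by
    change g (Quotient.mk _ ((g (Quotient.mk _ x))⁻¹ • x)) • (g (Quotient.mk _ x))⁻¹ • x = x
    rw [show (Quotient.mk _ ((g (Quotient.mk _ x))⁻¹ • x) : MulAction.orbitRel.Quotient G α) =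
      Quotient.mk _ x from Quotient.sound ⟨_, rfl⟩, smul_inv_smul]

theorem Subgroup.card_le_two_mul_card_inf_alternatingGroup {Ω : Type*} [Fintype Ω] [DecidableEq Ω]
    (D : Subgroup (Equiv.Perm Ω)) :
    Nat.card D ≤ 2 * Nat.card (D ⊓ alternatingGroup Ω : Subgroup (Equiv.Perm Ω)) := by
  let f := Equiv.Perm.sign.comp D.subtype
  have h1 := f.ker.card_eq_card_quotient_mul_card_subgroup
  rw [Nat.card_congr (QuotientGroup.quotientKerEquivRange f).toEquiv] at h1
  have h2 : Nat.card f.range ≤ 2 :=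
    (Subgroup.card_le_card_group f.range).trans (by simp [Nat.card_eq_fintype_card])
  have h3 : Nat.card f.ker ≤ Nat.card (D ⊓ alternatingGroup Ω : Subgroup (Equiv.Perm Ω)) :=
    Nat.card_le_card_of_injective
      (fun x => ⟨x.1.1, x.1.2, Equiv.Perm.mem_alternatingGroup.2 x.2⟩)
      fun x y h => Subtype.ext (Subtype.ext (Subtype.mk.inj h))
  rw [h1]
  exact Nat.mul_le_mul h2 h3

open MulAction in
/-- The centralizer of a fixed point freely acting finite `p`-group contains at least `2 ^ (k - 1)`
permutations fixing a given point, where `k` is the number of orbits. -/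
theorem IsPGroup.two_pow_le_card_centralizer_inf_stabilizer {p : ℕ} [Fact p.Prime] {Ω : Type*}
    [Finite Ω] {Q : Subgroup (Equiv.Perm Ω)} (hQ : IsPGroup p Q)
    (hfpf : ∀ ω : Ω, ∃ q ∈ Q, q ω ≠ ω) (ω : Ω) :
    2 ^ (Nat.card (orbitRel.Quotient Q Ω) - 1) ≤
      Nat.card (Subgroup.centralizer (Q : Set (Equiv.Perm Ω)) ⊓
        stabilizer (Equiv.Perm Ω) ω : Subgroup (Equiv.Perm Ω)) := by
  classical
  have key (x : Ω) := hQ.exists_smul_comm_on_orbit x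
    (let ⟨q, hq, hqx⟩ := hfpf x; ⟨⟨q, hq⟩, hqx⟩)
  choose z hz hzc using fun a : orbitRel.Quotient Q Ω => key a.out
  have hmem (x : Ω) : x ∈ orbit Q (Quotient.mk (orbitRel Q Ω) x).out :=
    (orbitRel Q Ω).symm (Quotient.mk_out (s := orbitRel Q Ω) x)
  let i : orbitRel.Quotient Q Ω := Quotient.mk _ ω
  let g (T : Set {a : orbitRel.Quotient Q Ω // a ≠ i}) (a : orbitRel.Quotient Q Ω) : Q :=
    if a ∈ Subtype.val '' T then z a else 1
  have hcard : Nat.card (Set {a : orbitRel.Quotient Q Ω // a ≠ i}) =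
      2 ^ (Nat.card (orbitRel.Quotient Q Ω) - 1) := by
    have := Fintype.ofFinite (orbitRel.Quotient Q Ω)
    simp [Nat.card_eq_fintype_card]
  rw [← hcard]
  refine Nat.card_le_card_of_injective (fun T => ⟨orbitwisePerm (g T), ?_, ?_⟩) ?_
  · refine Subgroup.mem_centralizer_iff.2 ?_
    intro h hh
    ext x
    change h (((g T (Quotient.mk _ x) : Q) • x)) = (g T (Quotient.mk _ (h x)) : Q) • h x
    have e : (Quotient.mk _ (h x) : orbitRel.Quotient Q Ω) = Quotient.mk _ x :=
      Quotient.sound ⟨⟨h, hh⟩, rfl⟩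
    rw [e]
    by_cases hT : (Quotient.mk _ x : orbitRel.Quotient Q Ω) ∈ Subtype.val '' T
    · simp only [g, if_pos hT]
      exact (hzc _ ⟨h, hh⟩ x (hmem x)).symm
    · simp only [g, if_neg hT, one_smul]
  · have hT : i ∉ Subtype.val '' T := by
      rintro ⟨a, -, ha⟩
      exact a.2 ha
    change g T i • ω = ω
    simp only [g, if_neg hT, one_smul]
  · intro S T hST
    have hST' : orbitwisePerm (g S) = orbitwisePerm (g T) := congrArg Subtype.val hST
    ext a
    obtain ⟨x, hx, hne⟩ := hz a.1
    have e : (Quotient.mk _ x : orbitRel.Quotient Q Ω) = a.1 :=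
      (Quotient.sound hx).trans (Quotient.out_eq _)
    have h : g S (Quotient.mk _ x) • x = g T (Quotient.mk _ x) • x := DFunLike.congr_fun hST' x
    rw [e] at h
    have hg (U : Set {a : orbitRel.Quotient Q Ω // a ≠ i}) : a ∈ U ↔ g U a.1 • x ≠ x := by
      by_cases hU : a ∈ U
      · simp only [g, if_pos (Set.mem_image_of_mem Subtype.val hU), hU, hne, ne_eq, not_false_iff]
      · have hU' : a.1 ∉ Subtype.val '' U := by
          rwa [Subtype.val_injective.mem_set_image]
        simp only [g, if_neg hU', hU, one_smul, ne_eq, not_true]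
    rw [hg S, hg T, h]

theorem permOrbit_eq_orbit {Ω : Type*} (Q : Subgroup (Equiv.Perm Ω)) (ω : Ω) :
    permOrbit Q ω = MulAction.orbit Q ω := by
  ext x
  exact ⟨fun ⟨q, hq, h⟩ => ⟨⟨q, hq⟩, h⟩, fun ⟨q, h⟩ => ⟨q, q.2, h⟩⟩

theorem card_permOrbit_eq_card_quotient {Ω : Type*} (Q : Subgroup (Equiv.Perm Ω)) :
    Nat.card {s : Set Ω // ∃ ω : Ω, s = permOrbit Q ω} =
      Nat.card (MulAction.orbitRel.Quotient Q Ω) := by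
  symm
  refine Nat.card_congr (Equiv.ofBijective
    (fun a => ⟨permOrbit Q a.out, a.out, rfl⟩) ⟨fun a b h => ?_, ?_⟩)
  · have h1 : permOrbit Q a.out = permOrbit Q b.out := congrArg Subtype.val h
    rw [permOrbit_eq_orbit, permOrbit_eq_orbit, MulAction.orbit_eq_iff] at h1
    rw [← Quotient.out_eq a, ← Quotient.out_eq b]
    exact Quotient.sound h1
  · rintro ⟨_, ω, rfl⟩
    refine ⟨Quotient.mk _ ω, Subtype.ext ?_⟩
    change permOrbit Q (Quotient.mk (MulAction.orbitRel Q Ω) ω).out = permOrbit Q ω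
    rw [permOrbit_eq_orbit, permOrbit_eq_orbit, MulAction.orbit_eq_iff]
    exact Quotient.mk_out (s := MulAction.orbitRel Q Ω) ω

/-- Let `Ω` be a finite set and let `Q ≤ Alt(Ω)` be a `2`-subgroup of the
alternating group on `Ω` acting fixed point freely on `Ω` and satisfying
`C_{Alt(Ω)}(Q) = Z(Q)`. If `Q` has exactly `k` orbits on `Ω` with `k ≥ 2`, then
`2^(k-2) · |Ω| ≤ k · |Q|`. -/
theorem card_orbit_bound_of_fixedPointFree_selfCentralizing
    (Ω : Type*) [Fintype Ω] [DecidableEq Ω]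
    (Q : Subgroup (Equiv.Perm Ω)) (hQA : Q ≤ alternatingGroup Ω)
    (hQ2 : IsPGroup 2 Q)
    (hfpf : ∀ ω : Ω, ∃ q ∈ Q, q ω ≠ ω)
    (hsc : Subgroup.centralizer (Q : Set (Equiv.Perm Ω)) ⊓ alternatingGroup Ω
      = Subgroup.centralizer (Q : Set (Equiv.Perm Ω)) ⊓ Q)
    (k : ℕ) (hk : 2 ≤ k)
    (hkcard : Nat.card {s : Set Ω // ∃ ω : Ω, s = permOrbit Q ω} = k) :
    2 ^ (k - 2) * Nat.card Ω ≤ k * Nat.card Q := by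
  classical
  have : Fact (Nat.Prime 2) := ⟨Nat.prime_two⟩
  rw [card_permOrbit_eq_card_quotient] at hkcard
  have horb (ω : Ω) : 2 ^ (k - 2) * Nat.card (MulAction.orbit Q ω) ≤ Nat.card Q := by
    have h1 := hQ2.two_pow_le_card_centralizer_inf_stabilizer hfpf ω
    have h2 := Subgroup.card_le_two_mul_card_inf_alternatingGroup
      (Subgroup.centralizer (Q : Set (Equiv.Perm Ω)) ⊓ MulAction.stabilizer (Equiv.Perm Ω) ω)
    have h3 : Nat.card (Subgroup.centralizer (Q : Set (Equiv.Perm Ω)) ⊓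
        MulAction.stabilizer (Equiv.Perm Ω) ω ⊓ alternatingGroup Ω : Subgroup (Equiv.Perm Ω)) ≤
        Nat.card (MulAction.stabilizer Q ω) := by
      have hQmem (x : Equiv.Perm Ω) (hx : x ∈ Subgroup.centralizer (Q : Set (Equiv.Perm Ω)) ⊓
          MulAction.stabilizer (Equiv.Perm Ω) ω ⊓ alternatingGroup Ω) : x ∈ Q :=
        (hsc.le ⟨hx.1.1, hx.2⟩).2
      exact Nat.card_le_card_of_injective (fun x => ⟨⟨x.1, hQmem x.1 x.2⟩, x.2.1.2⟩)
        fun x y h => Subtype.ext (congrArg (fun z => z.1.1) h)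
    have h4 : Nat.card (MulAction.orbit Q ω) * Nat.card (MulAction.stabilizer Q ω) =
        Nat.card Q := by
      rw [← Nat.card_prod,
        Nat.card_congr (MulAction.orbitProdStabilizerEquivGroup Q ω)]
    rw [hkcard, show k - 1 = k - 2 + 1 by omega, pow_succ] at h1
    rw [← h4, mul_comm]
    exact Nat.mul_le_mul_left _ (by omega)
  have := Fintype.ofFinite (MulAction.orbitRel.Quotient Q Ω)
  rw [Nat.card_congr (MulAction.selfEquivSigmaOrbits Q Ω), Nat.card_sigma, Finset.mul_sum]
  refine (Finset.sum_le_card_nsmul _ _ _ fun a _ => horb a.out).trans_eq ?_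
  rw [Finset.card_univ, ← Nat.card_eq_fintype_card, hkcard, smul_eq_mul]
end
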